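/- Let m > 0 be a real number and define α : ℝ → ℝ by α(k) = 2((8-√19)m - 2(√19+1))·k^(1+(2√19)/5) - 4√19(m-2)·k^((8+√19)/5) + 2((8+√19)m - 2(√19-1))·k^((2√19)/5) - 2((8+√19)m + 2(√19-1))·k + 4√19(m+2)·k^((√19-3)/5) - 2((8-√19)m + 2(√19+1)), where real powers are the real power function. Then there exists k* with 0 < k* < 1 such that α(k*) = 0. -/

import Mathlib

open Filter Topology

/-- A function vanishing at `0` with negative derivative just to the left of `0` is positive just
to the left of `0`. -/
lemma eventually_pos_left_of_deriv_neg {f f' : ℝ → ℝ} (hf : ∀ x, HasDerivAt f (f' x) x)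
    (h0 : f 0 = 0) (hneg : ∀ᶠ x in 𝓝[<] 0, f' x < 0) : ∀ᶠ x in 𝓝[<] 0, 0 < f x := by
  obtain ⟨l, hl, hlt⟩ := mem_nhdsLT_iff_exists_Ioo_subset.mp hneg
  filter_upwards [Ioo_mem_nhdsLT hl] with x hx
  have hanti : StrictAntiOn f (Set.Icc x 0) := by
    refine strictAntiOn_of_deriv_neg (convex_Icc x 0)
      (fun y _ => (hf y).continuousAt.continuousWithinAt) fun y hy => ?_
    rw [interior_Icc] at hy
    rw [(hf y).deriv]
    exact hlt ⟨hx.1.trans hy.1, hy.2⟩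
  have := hanti (Set.left_mem_Icc.mpr hx.2.le) (Set.right_mem_Icc.mpr hx.2.le) hx.2
  rwa [h0] at this

/-- A function vanishing at `0` with positive derivative just to the left of `0` is negative just
to the left of `0`. -/
lemma eventually_neg_left_of_deriv_pos {f f' : ℝ → ℝ} (hf : ∀ x, HasDerivAt f (f' x) x)
    (h0 : f 0 = 0) (hpos : ∀ᶠ x in 𝓝[<] 0, 0 < f' x) : ∀ᶠ x in 𝓝[<] 0, f x < 0 := by
  have := eventually_pos_left_of_deriv_neg (f := fun x => -f x) (fun x => (hf x).neg)
    (by simp [h0]) (hpos.mono fun x hx => neg_neg_of_pos hx)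
  exact this.mono fun x hx => neg_pos.mp hx

/-- An exponential sum whose moments of order `0`, `1`, `2` vanish and whose third moment is
negative is positive just to the left of `0`. -/
lemma eventually_pos_left_exp_sum {ι : Type*} [Fintype ι] (c a : ι → ℝ)
    (h0 : ∑ i, c i = 0) (h1 : ∑ i, c i * a i = 0) (h2 : ∑ i, c i * a i ^ 2 = 0)
    (h3 : ∑ i, c i * a i ^ 3 < 0) :
    ∀ᶠ x in 𝓝[<] 0, 0 < ∑ i, c i * Real.exp (a i * x) := by
  have hd : ∀ (n : ℕ) (x : ℝ), HasDerivAt (fun x => ∑ i, c i * a i ^ n * Real.exp (a i * x))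
      (∑ i, c i * a i ^ (n + 1) * Real.exp (a i * x)) x := by
    intro n x
    refine HasDerivAt.fun_sum fun i _ => ?_
    refine ((((hasDerivAt_id x).const_mul (a i)).exp).const_mul (c i * a i ^ n)).congr_deriv ?_
    simp only [id]
    ring
  have e3 : ∀ᶠ x in 𝓝[<] (0 : ℝ), ∑ i, c i * a i ^ 3 * Real.exp (a i * x) < 0 := by
    have hc := (hd 3 0).continuousAt
    exact nhdsWithin_le_nhds (hc.eventually_lt_const (by simpa using h3))
  have e2 := eventually_pos_left_of_deriv_neg (hd 2) (by simpa using h2) e3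
  have e1 := eventually_neg_left_of_deriv_pos (hd 1) (by simpa using h1) e2
  simpa using eventually_pos_left_of_deriv_neg (hd 0) (by simpa using h0) e1

/-- for `m > 0`, the function `α` below has a root `k*` with `0 < k* < 1`. -/
theorem stmt7 (m : ℝ) (hm : 0 < m) :
    let α : ℝ → ℝ := fun k =>
      2 * ((8 - Real.sqrt 19) * m - 2 * (Real.sqrt 19 + 1)) * k ^ (1 + 2 * Real.sqrt 19 / 5)
        - 4 * Real.sqrt 19 * (m - 2) * k ^ ((8 + Real.sqrt 19) / 5)
        + 2 * ((8 + Real.sqrt 19) * m - 2 * (Real.sqrt 19 - 1)) * k ^ (2 * Real.sqrt 19 / 5)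
        - 2 * ((8 + Real.sqrt 19) * m + 2 * (Real.sqrt 19 - 1)) * k
        + 4 * Real.sqrt 19 * (m + 2) * k ^ ((Real.sqrt 19 - 3) / 5)
        - 2 * ((8 - Real.sqrt 19) * m + 2 * (Real.sqrt 19 + 1))
    ∃ kstar : ℝ, 0 < kstar ∧ kstar < 1 ∧ α kstar = 0 := by
  intro α
  set s := Real.sqrt 19
  have hs : s ^ 2 = 19 := Real.sq_sqrt (by norm_num)
  have hs4 : 4 < s := Real.lt_sqrt_of_sq_lt (by norm_num)
  have hs5 : s < 5 := by nlinarith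
  have hcont : Continuous α := by
    have h : ∀ p : ℝ, 0 ≤ p → Continuous fun k : ℝ => k ^ p := fun p hp =>
      Real.continuous_rpow_const hp
    have q1 := h (1 + 2 * s / 5) (by linarith)
    have q2 := h ((8 + s) / 5) (by linarith)
    have q3 := h (2 * s / 5) (by linarith)
    have q4 := h ((s - 3) / 5) (by linarith)
    fun_prop
  have hzero : α 0 < 0 := by
    simp only [α]
    rw [Real.zero_rpow (by linarith), Real.zero_rpow (by linarith), Real.zero_rpow (by linarith),
      Real.zero_rpow (by linarith)]
    nlinarith
  obtain ⟨x, hx0, hx⟩ : ∃ x < 0, 0 < α (Real.exp x) := by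
    have key := eventually_pos_left_exp_sum
      ![2 * ((8 - s) * m - 2 * (s + 1)), -(4 * s * (m - 2)), 2 * ((8 + s) * m - 2 * (s - 1)),
        -(2 * ((8 + s) * m + 2 * (s - 1))), 4 * s * (m + 2), -(2 * ((8 - s) * m + 2 * (s + 1)))]
      ![1 + 2 * s / 5, (8 + s) / 5, 2 * s / 5, 1, (s - 3) / 5, 0]
      (by simp [Fin.sum_univ_succ]; ring)
      (by simp [Fin.sum_univ_succ]; grind)
      (by simp [Fin.sum_univ_succ]; grind)
      (by
        have : -(36 * s / 25) * m < 0 := by nlinarith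
        refine lt_of_eq_of_lt ?_ this
        simp [Fin.sum_univ_succ]; grind)
    obtain ⟨x, hx, hx0⟩ := (key.and self_mem_nhdsWithin).exists
    refine ⟨x, hx0, hx.trans_eq ?_⟩
    simp only [α, ← Real.exp_mul]
    simp [Fin.sum_univ_succ, mul_comm x]
    ring
  obtain ⟨k, hk, hk0⟩ := intermediate_value_Ioo (Real.exp_pos x).le hcont.continuousOn ⟨hzero, hx⟩
  exact ⟨k, hk.1, hk.2.trans (Real.exp_lt_one_iff.mpr hx0), hk0⟩
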